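/- arXiv:2102.08670 — 3 statements merged into one kernel-verified Lean document; each statement's English description precedes it below -/
import Mathlib

section
/- Let (i,j,p) be a decreasing run in a string S of length n. Then for every index k ∈ [i, i+p) it holds that S_k ≻ S_{k+p}; consequently nss(k) ≤ k + p and λ[k] ≤ p. -/
open List

variable {α : Type*} [LinearOrder α]

/-- The substring `S[i..j]` (1-based, both endpoints inclusive). -/
def sub (S : ℕ → α) (i j : ℕ) : List α := (List.range' i (j + 1 - i)).map S

/-- The suffix `S_i = S[i..n]` (empty for `i = n + 1`). -/
def suf (S : ℕ → α) (n i : ℕ) : List α := sub S i n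

/-- The prefix `S[1..i]`. -/
def pre (S : ℕ → α) (i : ℕ) : List α := sub S 1 i

/-- Strict lexicographic order `≺` on strings. -/
def slt (l₁ l₂ : List α) : Prop := List.Lex (· < ·) l₁ l₂

/-- Length of the longest common prefix of two lists. -/
def lcpLen (l₁ l₂ : List α) : ℕ :=
  Nat.findGreatest (fun k => l₁.take k = l₂.take k) (min l₁.length l₂.length)

/-- `rlce S n i j` : length of the longest common prefix of suffixes `S_i` and `S_j`. -/
def rlce (S : ℕ → α) (n i j : ℕ) : ℕ := lcpLen (suf S n i) (suf S n j)

/-- `llce S i j` : length of the longest common suffix of prefixes `S[1..i]` and `S[1..j]`. -/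
def llce (S : ℕ → α) (i j : ℕ) : ℕ := lcpLen (pre S i).reverse (pre S j).reverse

/-- Next-smaller-suffix array: `nss S n i = min { j | j = n+1 ∨ (i < j ≤ n ∧ S_j ≺ S_i) }`. -/
noncomputable def nss (S : ℕ → α) (n i : ℕ) : ℕ :=
  sInf {j | j = n + 1 ∨ (i < j ∧ j ≤ n ∧ slt (suf S n j) (suf S n i))}

/-- A Lyndon word: nonempty and strictly smaller than each of its non-trivial cyclic shifts. -/
def IsLyndon (l : List α) : Prop :=
  l ≠ [] ∧ ∀ k, 0 < k → k < l.length → slt l (l.drop k ++ l.take k)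

/-- The Lyndon array: `lyn S n i = max { j - i + 1 | i ≤ j ≤ n, S[i..j] is a Lyndon word }`. -/
noncomputable def lyn (S : ℕ → α) (n i : ℕ) : ℕ :=
  sSup {m | ∃ j, i ≤ j ∧ j ≤ n ∧ IsLyndon (sub S i j) ∧ m = j - i + 1}

/-- `p ≥ 1` is a period of `S[i..j]`: `S[x] = S[x+p]` for all `x ∈ [i, j - p]`. -/
def IsPeriod (S : ℕ → α) (i j p : ℕ) : Prop :=
  1 ≤ p ∧ ∀ x, i ≤ x → x + p ≤ j → S x = S (x + p)

/-- A run `(i,j,p)` in a string of length `n`. -/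
def IsRun (S : ℕ → α) (n i j p : ℕ) : Prop :=
  1 ≤ i ∧ i ≤ j ∧ j ≤ n ∧
  IsPeriod S i j p ∧ (∀ q, 1 ≤ q → q < p → ¬ IsPeriod S i j q) ∧
  2 * p ≤ j - i + 1 ∧
  (1 < i → ¬ IsPeriod S (i - 1) j p) ∧
  (j < n → ¬ IsPeriod S i (j + 1) p)

/-- A (lexicographically) decreasing run: a run with `S_i ≻ S_{i+p}`. -/
def IsDecRun (S : ℕ → α) (n i j p : ℕ) : Prop :=
  IsRun S n i j p ∧ slt (suf S n (i + p)) (suf S n i)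

theorem slt_irrefl (a : List α) : ¬ slt a a := lt_irrefl a

theorem slt_asymm {a b : List α} (h : slt a b) : ¬ slt b a := lt_asymm (a := a) (b := b) h

theorem slt_cons_self_iff {x : α} {a b : List α} : slt (x :: a) (x :: b) ↔ slt a b :=
  List.cons_lt_cons_self

theorem slt_append_left_iff {v a b : List α} : slt (v ++ a) (v ++ b) ↔ slt a b := by
  induction v with
  | nil => rfl
  | cons x v ih => exact slt_cons_self_iff.trans ih

/-- A smaller string is a prefix of the larger one or they differ at a mismatching letter,
in which case the comparison survives arbitrary extensions. -/
theorem slt.prefix_or_append {v w : List α} (h : slt v w) :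
    v <+: w ∨ ∀ r s, slt (v ++ r) (w ++ s) := by
  unfold slt at h
  induction h with
  | nil => exact .inl List.nil_prefix
  | rel h => exact .inr fun _ _ => List.Lex.rel h
  | cons _ ih =>
    refine ih.imp (fun h => ?_) fun h r s => List.Lex.cons (h r s)
    exact List.cons_prefix_cons.2 ⟨rfl, h⟩

theorem slt.append_of_length_le {v w : List α} (h : slt v w) (hl : w.length ≤ v.length)
    (r s : List α) : slt (v ++ r) (w ++ s) := by
  rcases h.prefix_or_append with hp | hm
  · exact absurd (hp.eq_of_length_le hl ▸ h) (slt_irrefl _)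
  · exact hm r s

/-- A Lyndon word is strictly smaller than each of its proper non-empty suffixes. -/
theorem IsLyndon.slt_drop {w : List α} (hw : IsLyndon w) {k : ℕ} (h0 : 0 < k)
    (hk : k < w.length) : slt w (w.drop k) := by
  have hlen : (w.drop k).length = w.length - k := List.length_drop
  rcases lt_trichotomy w (w.drop k) with h | h | h
  · exact h
  · have := congrArg List.length h
    omega
  · exfalso
    have hrot := hw.2 k h0 hk
    rcases slt.prefix_or_append h with ⟨t, ht⟩ | hm
    · have hlen' := congrArg List.length ht
      rw [List.length_append] at hlen'
      have htu : slt t (w.take k) := by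
        rw [← slt_append_left_iff (v := w.drop k), ht]
        exact hrot
      have hlt := htu.append_of_length_le (by rw [List.length_take]; omega)
        (w.drop k) (w.drop k)
      rw [List.take_append_drop] at hlt
      have hrot' := hw.2 (w.drop k).length (by omega) (by omega)
      have hd : w.drop (w.drop k).length = t :=
        (congrArg (List.drop _) ht.symm).trans List.drop_left
      have ht' : w.take (w.drop k).length = w.drop k :=
        (congrArg (List.take _) ht.symm).trans List.take_left
      rw [hd, ht'] at hrot'
      exact slt_asymm hrot' hlt
    · have := hm (w.take k) []
      rw [List.append_nil] at this
      exact slt_asymm hrot this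

theorem length_sub {β : Type*} (S : ℕ → β) (i j : ℕ) : (sub S i j).length = j + 1 - i := by
  simp [sub]

theorem sub_eq_cons {β : Type*} (S : ℕ → β) {i j : ℕ} (h : i ≤ j) : sub S i j = S i :: sub S (i + 1) j := by
  have : j + 1 - i = (j + 1 - (i + 1)) + 1 := by omega
  rw [sub, this, List.range'_succ, List.map_cons, sub]

theorem sub_append_sub {β : Type*} (S : ℕ → β) {i j n : ℕ} (hi : i ≤ j + 1) (hj : j ≤ n) :
    sub S i j ++ sub S (j + 1) n = sub S i n := by
  have h : j + 1 = i + (j + 1 - i) := by omega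
  have h' : n + 1 - i = (j + 1 - i) + (n + 1 - (j + 1)) := by omega
  rw [sub, sub, sub, ← List.map_append, h', ← List.range'_append_1, ← h]

theorem drop_sub {β : Type*} (S : ℕ → β) (i j p : ℕ) : (sub S i j).drop p = sub S (i + p) j := by
  simp [sub, ← List.map_drop, List.drop_range', Nat.sub_sub]

theorem slt_suf_succ {S : ℕ → α} {n x y : ℕ} (hx : x ≤ n) (hy : y ≤ n) (he : S x = S y)
    (h : slt (suf S n y) (suf S n x)) : slt (suf S n (y + 1)) (suf S n (x + 1)) := by
  rw [suf, suf, sub_eq_cons S hx, sub_eq_cons S hy, he] at h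
  exact slt_cons_self_iff.1 h

theorem nss_le {S : ℕ → α} {n k m : ℕ} (hk : k < m) (hm : m ≤ n)
    (h : slt (suf S n m) (suf S n k)) : nss S n k ≤ m :=
  Nat.sInf_le (.inr ⟨hk, hm, h⟩)

theorem lyn_le {S : ℕ → α} {n k p : ℕ} (hp : 0 < p)
    (h : slt (suf S n (k + p)) (suf S n k)) : lyn S n k ≤ p := by
  refine csSup_le' ?_
  rintro m ⟨e, hke, hen, hw, rfl⟩
  by_contra! hlt
  have hdrop := hw.slt_drop hp (by rw [length_sub]; omega)
  rw [drop_sub] at hdrop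
  have := hdrop.append_of_length_le (by rw [length_sub, length_sub]; omega)
    (sub S (e + 1) n) (sub S (e + 1) n)
  rw [sub_append_sub S (by omega) hen, sub_append_sub S (by omega) hen] at this
  exact slt_asymm h this

/-- For a decreasing run `(i,j,p)` and any `k ∈ [i, i+p)`:
`S_k ≻ S_{k+p}`, hence `nss(k) ≤ k + p` and `λ[k] ≤ p`. -/
theorem stmt_4 (S : ℕ → α) (n i j p : ℕ) (h : IsDecRun S n i j p) :
    ∀ k, i ≤ k → k < i + p →
      slt (suf S n (k + p)) (suf S n k) ∧ nss S n k ≤ k + p ∧ lyn S n k ≤ p := by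
  obtain ⟨⟨_, hij, hjn, ⟨hp, hper⟩, _, hlen, _, _⟩, hdec⟩ := h
  intro k hik hk
  have hslt : slt (suf S n (k + p)) (suf S n k) := by
    induction k, hik using Nat.le_induction with
    | base => exact hdec
    | succ x hix ih =>
      rw [Nat.add_right_comm]
      exact slt_suf_succ (by omega) (by omega) (hper x hix (by omega)) (ih (by omega))
  exact ⟨hslt, nss_le (by omega) (by omega) hslt, lyn_le hp hslt⟩
end

section
/- Let (i,j,p) be a decreasing run in a string S of length n that is rooted in i0. Then nss(i0) = i0 + p, llce(i0, i0 + p) = i0 − i + 1 (which is at most p), and rlce(i0, i0 + p) = j − i0 − p + 1. -/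
open List

variable {α : Type*} [LinearOrder α]

theorem getElem_sub {β : Type*} (S : ℕ → β) (i j t : ℕ) (h : t < (sub S i j).length) :
    (sub S i j)[t] = S (i + t) := by
  simp [sub]

theorem getElem_reverse_pre {β : Type*} (S : ℕ → β) (i t : ℕ) (h : t < (pre S i).reverse.length) :
    (pre S i).reverse[t] = S (i - t) := by
  have h' : t < i := by simpa [pre, length_sub] using h
  rw [List.getElem_reverse]
  simp only [pre, getElem_sub, length_sub]
  congr 1
  omega

theorem slt_iff (l₁ l₂ : List α) : slt l₁ l₂ ↔
    (l₁ = l₂.take l₁.length ∧ l₁.length < l₂.length) ∨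
      ∃ t, ∃ (h₁ : t < l₁.length) (h₂ : t < l₂.length),
        (∀ s, ∀ hs : s < t, l₁[s] = l₂[s]) ∧ l₁[t] < l₂[t] :=
  List.lt_iff_exists (l₁ := l₁) (l₂ := l₂)

/-- Comparison of two suffixes through their first mismatch. -/
theorem slt_suf_iff (S : ℕ → α) (n a b : ℕ) : slt (suf S n a) (suf S n b) ↔
    ∃ t, (∀ s < t, S (a + s) = S (b + s)) ∧
      ((t = n + 1 - a ∧ b + t ≤ n) ∨ (a + t ≤ n ∧ b + t ≤ n ∧ S (a + t) < S (b + t))) := by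
  simp only [slt_iff, suf, getElem_sub, length_sub]
  constructor
  · rintro (⟨h, hl⟩ | ⟨t, h₁, h₂, h, hlt⟩)
    · refine ⟨n + 1 - a, fun s hs => ?_, Or.inl ⟨rfl, by omega⟩⟩
      have := congrArg (fun l => l[s]?) h
      simpa [sub, hs, show s < n + 1 - b by omega] using this
    · exact ⟨t, h, Or.inr ⟨by omega, by omega, hlt⟩⟩
  · rintro ⟨t, h, ⟨ht, hb⟩ | ⟨ha, hb, hlt⟩⟩
    · refine Or.inl ⟨List.ext_getElem ?_ fun s hs _ => ?_, by omega⟩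
      · simp only [List.length_take, length_sub]
        omega
      · rw [length_sub] at hs
        rw [List.getElem_take, getElem_sub, getElem_sub]
        exact h s (by omega)
    · exact Or.inr ⟨t, by omega, by omega, h, hlt⟩

theorem lcpLen_eq {l₁ l₂ : List α} {k : ℕ} (h₁ : k ≤ l₁.length) (h₂ : k ≤ l₂.length)
    (heq : ∀ t, ∀ ht : t < k, l₁[t] = l₂[t])
    (hne : ∀ (g₁ : k < l₁.length) (g₂ : k < l₂.length), l₁[k] ≠ l₂[k]) :
    lcpLen l₁ l₂ = k := by
  rw [lcpLen, Nat.findGreatest_eq_iff]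
  refine ⟨le_min h₁ h₂, fun _ => ?_, fun m hm hml h => ?_⟩
  · refine List.ext_getElem (by simp [h₁, h₂]) fun t ht _ => ?_
    rw [List.getElem_take, List.getElem_take]
    exact heq t (by simp at ht; omega)
  · have g₁ : k < l₁.length := by omega
    have g₂ : k < l₂.length := by omega
    have := congrArg (fun l => l[k]?) h
    exact hne g₁ g₂ (by simpa [hm, g₁, g₂] using this)

theorem exists_lt_rotation_of_isLyndon {S : ℕ → α} {a b k : ℕ} (h : IsLyndon (sub S a b))
    (hk : 0 < k) (hkp : k < b + 1 - a) :
    ∃ t < b + 1 - a,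
      (∀ s < t, S (a + s) =
        if s < b + 1 - a - k then S (a + (k + s)) else S (a + (s - (b + 1 - a - k)))) ∧
      S (a + t) <
        if t < b + 1 - a - k then S (a + (k + t)) else S (a + (t - (b + 1 - a - k))) := by
  have hlen := length_sub S a b
  rcases (slt_iff _ _).1 (h.2 k hk (by omega)) with ⟨_, hl⟩ | ⟨t, h₁, h₂, heq, hlt⟩
  · simp only [List.length_append, List.length_drop, List.length_take] at hl
    omega
  · simp only [List.getElem_append, List.getElem_drop, List.getElem_take, List.length_drop,
      getElem_sub, hlen, dite_eq_ite] at heq hlt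
    exact ⟨t, by omega, heq, hlt⟩

/-- A Lyndon word has a mismatch with each of its proper suffixes, and it is smaller there. -/
theorem exists_lt_suffix_of_isLyndon {S : ℕ → α} {a b k : ℕ} (h : IsLyndon (sub S a b))
    (hk : 0 < k) (hkp : k < b + 1 - a) :
    ∃ t, t < b + 1 - a - k ∧ (∀ s < t, S (a + s) = S (a + (k + s))) ∧
      S (a + t) < S (a + (k + t)) := by
  obtain ⟨t, ht, heq, hlt⟩ := exists_lt_rotation_of_isLyndon h hk hkp
  obtain ⟨t', ht', heq', hlt'⟩ := exists_lt_rotation_of_isLyndon h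
    (k := b + 1 - a - k) (by omega) (by omega)
  generalize b + 1 - a = p at *
  by_cases htk : t < p - k
  · refine ⟨t, htk, fun s hs => ?_, by simpa [htk] using hlt⟩
    simpa [show s < p - k by omega] using heq s hs
  exfalso
  rw [if_neg htk] at hlt
  obtain ⟨r, rfl⟩ : ∃ r, t = p - k + r := ⟨t - (p - k), by omega⟩
  have hpk : p - (p - k) = k := by omega
  simp only [hpk] at heq' hlt'
  rw [Nat.add_sub_cancel_left] at hlt
  have border : ∀ s < r, S (a + (p - k + s)) = S (a + s) := fun s hs => by
    simpa using heq (p - k + s) (by omega)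
  rcases lt_or_ge r t' with hr | hr
  · have := heq' r hr
    rw [if_pos (by omega)] at this
    exact hlt.ne this.symm
  · rw [if_pos (by omega)] at hlt'
    rcases hr.lt_or_eq with hr | rfl
    · exact hlt'.ne (border t' hr).symm
    · exact hlt.asymm hlt'

theorem isLyndon_of_lyn_eq {S : ℕ → α} {n a p : ℕ} (hp : 1 ≤ p) (h : lyn S n a = p) :
    a + p ≤ n + 1 ∧ IsLyndon (sub S a (a + p - 1)) := by
  have hbdd : BddAbove {m | ∃ j, a ≤ j ∧ j ≤ n ∧ IsLyndon (sub S a j) ∧ m = j - a + 1} :=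
    ⟨n + 1, by rintro m ⟨j, _, _, _, rfl⟩; omega⟩
  have hne : {m | ∃ j, a ≤ j ∧ j ≤ n ∧ IsLyndon (sub S a j) ∧ m = j - a + 1}.Nonempty := by
    by_contra hempty
    rw [lyn, Set.not_nonempty_iff_eq_empty.1 hempty, csSup_empty] at h
    simp only [bot_eq_zero'] at h
    omega
  obtain ⟨j, haj, hjn, hL, hm⟩ := Nat.sSup_mem hne hbdd
  rw [← lyn, h] at hm
  obtain rfl : j = a + p - 1 := by omega
  exact ⟨by omega, hL⟩

theorem not_slt_of_isLyndon {S : ℕ → α} {n a b k : ℕ} (h : IsLyndon (sub S a b))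
    (hb : b ≤ n) (hk : a < k) (hkb : k ≤ b) : ¬ slt (suf S n k) (suf S n a) := by
  obtain ⟨t, ht, heq, hlt⟩ :=
    exists_lt_suffix_of_isLyndon h (k := k - a) (by omega) (by omega)
  have hshift : ∀ s, a + (k - a + s) = k + s := fun s => by omega
  simp only [hshift] at heq hlt
  rw [slt_suf_iff]
  rintro ⟨u, hu, ⟨rfl, _⟩ | ⟨_, _, hult⟩⟩
  · exact hlt.ne (hu t (by omega)).symm
  · rcases lt_trichotomy t u with htu | rfl | htu
    · exact hlt.ne (hu t htu).symm
    · exact hlt.asymm hult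
    · exact hult.ne (heq u htu).symm

/-- The order of two suffixes is unchanged by dropping equally long equal prefixes. -/
theorem slt_suf_add {S : ℕ → α} {n a b d : ℕ} (h : slt (suf S n a) (suf S n b))
    (heq : ∀ s < d, S (a + s) = S (b + s)) (ha : a + d ≤ n + 1) :
    slt (suf S n (a + d)) (suf S n (b + d)) := by
  rw [slt_suf_iff] at h ⊢
  obtain ⟨t, ht, hmis⟩ := h
  have hdt : d ≤ t := by
    by_contra hdt
    rcases hmis with ⟨_, _⟩ | ⟨_, _, hlt⟩
    · omega
    · exact hlt.ne (heq t (by omega))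
  obtain ⟨u, rfl⟩ := Nat.exists_eq_add_of_le hdt
  refine ⟨u, fun s hs => ?_, ?_⟩
  · simpa only [add_assoc] using ht (d + s) (by omega)
  · rw [add_assoc, add_assoc]
    exact hmis.imp (fun h => ⟨by omega, h.2⟩) id

theorem IsRun.ne_left {β : Type*} {S : ℕ → β} {n i j p : ℕ} (h : IsRun S n i j p) (hi : 1 < i) :
    S (i - 1) ≠ S (i - 1 + p) := by
  obtain ⟨_, _, _, hper, _, _, hleft, _⟩ := h
  refine fun he => hleft hi ⟨hper.1, fun x hx hxj => ?_⟩
  rcases hx.eq_or_lt with rfl | hx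
  · exact he
  · exact hper.2 x (by omega) hxj

theorem IsRun.ne_right {β : Type*} {S : ℕ → β} {n i j p : ℕ} (h : IsRun S n i j p) (hj : j < n) :
    S (j + 1 - p) ≠ S (j + 1) := by
  obtain ⟨_, _, _, hper, _, hlen, _, hright⟩ := h
  refine fun he => hright hj ⟨hper.1, fun x hx hxj => ?_⟩
  rcases hxj.eq_or_lt with hxj | hxj
  · rw [hxj, ← he]
    congr 1
    omega
  · exact hper.2 x hx (by omega)

theorem nss_eq_of_isDecRun {S : ℕ → α} {n i j p a : ℕ} (h : IsDecRun S n i j p)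
    (h₁ : i ≤ a) (h₂ : a < i + p) (h₃ : lyn S n a = p) : nss S n a = a + p := by
  obtain ⟨⟨_, _, hjn, hper, _, hlen, _, _⟩, hdec⟩ := h
  have hp := hper.1
  obtain ⟨hap, hL⟩ := isLyndon_of_lyn_eq hp h₃
  have hslt : slt (suf S n (a + p)) (suf S n a) := by
    have := slt_suf_add (d := a - i) hdec (fun s hs => ?_) (by omega)
    · rwa [show i + p + (a - i) = a + p by omega, show i + (a - i) = a by omega] at this
    · rw [hper.2 (i + s) (by omega) (by omega)]
      congr 1
      omega
  refine IsLeast.csInf_eq ⟨Or.inr ⟨by omega, by omega, hslt⟩, ?_⟩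
  rintro k (rfl | ⟨hak, _, hk⟩)
  · exact hap
  · by_contra hlt
    exact not_slt_of_isLyndon hL (by omega) hak (by omega) hk

theorem llce_eq_of_isRun {S : ℕ → α} {n i j p a : ℕ} (h : IsRun S n i j p)
    (h₁ : i ≤ a) (h₂ : a + p ≤ j) : llce S a (a + p) = a - i + 1 := by
  have hleft := h.ne_left
  obtain ⟨hi, _, _, hper, _⟩ := h
  have hlen : ∀ m, (pre S m).reverse.length = m := fun m => by simp [pre, length_sub]
  refine lcpLen_eq (by rw [hlen]; omega) (by rw [hlen]; omega) (fun t ht => ?_) fun g₁ g₂ => ?_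
  · rw [getElem_reverse_pre, getElem_reverse_pre, hper.2 (a - t) (by omega) (by omega)]
    congr 1
    omega
  · rw [hlen] at g₁
    rw [getElem_reverse_pre, getElem_reverse_pre, show a - (a - i + 1) = i - 1 by omega,
      show a + p - (a - i + 1) = i - 1 + p by omega]
    exact hleft (by omega)

theorem rlce_eq_of_isRun {S : ℕ → α} {n i j p a : ℕ} (h : IsRun S n i j p)
    (h₁ : i ≤ a) (h₂ : a + p ≤ j) : rlce S n a (a + p) = j - a - p + 1 := by
  have hright := h.ne_right
  obtain ⟨_, _, hjn, hper, _⟩ := h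
  have hlen : ∀ m, (suf S n m).length = n + 1 - m := fun m => length_sub S m n
  refine lcpLen_eq (by rw [hlen]; omega) (by rw [hlen]; omega) (fun t ht => ?_) fun g₁ g₂ => ?_
  · simp only [suf, getElem_sub]
    rw [hper.2 (a + t) (by omega) (by omega)]
    congr 1
    omega
  · rw [hlen] at g₂
    simp only [suf, getElem_sub]
    rw [show a + (j - a - p + 1) = j + 1 - p by omega,
      show a + p + (j - a - p + 1) = j + 1 by omega]
    exact hright (by omega)

/-- For a decreasing run `(i,j,p)` rooted in `i0`:
`nss(i0) = i0 + p`, `llce(i0, i0+p) = i0 - i + 1 ≤ p`, and `rlce(i0, i0+p) = j - i0 - p + 1`. -/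
theorem stmt_8 (S : ℕ → α) (n i j p i0 : ℕ) (h : IsDecRun S n i j p)
    (h1 : i ≤ i0) (h2 : i0 < i + p) (h3 : lyn S n i0 = p) :
    nss S n i0 = i0 + p ∧
    llce S i0 (i0 + p) = i0 - i + 1 ∧ i0 - i + 1 ≤ p ∧
    rlce S n i0 (i0 + p) = j - i0 - p + 1 := by
  have hbounds : 2 * p ≤ j - i + 1 := h.1.2.2.2.2.2.1
  exact ⟨nss_eq_of_isDecRun h h1 h2 h3, llce_eq_of_isRun h.1 h1 (by omega), by omega,
    rlce_eq_of_isRun h.1 h1 (by omega)⟩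
end

section
/- Let S be a string of length n, let nss(i') = j' with j' ≤ n, let ℓ' = rlce(i', j') and d = j' − i'. Let i, j ∈ [1,n] satisfy nss(i) = j, j' < i, and j < j' + ℓ'. If nss(i − d) ≠ j − d, then rlce(i,j) ≥ j' + ℓ' − j. -/
open List

variable {α : Type*} [LinearOrder α]

theorem suf_eq_cons (S : ℕ → α) {n a : ℕ} (h : a ≤ n) :
    suf S n a = S a :: suf S n (a + 1) := by
  have e : n + 1 - a = (n + 1 - (a + 1)) + 1 := by omega
  simp only [suf, sub]
  rw [e, List.range'_succ, List.map_cons]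

theorem length_suf (S : ℕ → α) (n a : ℕ) : (suf S n a).length = n + 1 - a := by
  simp [suf, sub]

theorem take_suf (S : ℕ → α) {n a m : ℕ} (h : a + m ≤ n + 1) :
    (suf S n a).take m = (List.range m).map (fun t => S (a + t)) := by
  apply List.ext_getElem
  · simp [length_suf]; omega
  · intro t h₁ h₂
    simp [suf, sub]

/-- At the first mismatch, the order of two suffixes is the order of the mismatching letters. -/
theorem slt_suf_iff_of_mismatch (S : ℕ → α) {n r : ℕ} : ∀ {a b : ℕ}, a + r ≤ n → b + r ≤ n →
    (∀ t < r, S (a + t) = S (b + t)) → S (a + r) ≠ S (b + r) →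
    (slt (suf S n a) (suf S n b) ↔ S (a + r) < S (b + r)) := by
  induction r with
  | zero =>
    intro a b ha hb _ hne
    rw [suf_eq_cons S (show a ≤ n by omega), suf_eq_cons S (show b ≤ n by omega), slt,
      List.cons_lex_cons_iff]
    simp only [Nat.add_zero] at hne ⊢
    simp [hne]
  | succ r ih =>
    intro a b ha hb heq hne
    have h0 : S a = S b := heq 0 (by omega)
    have hshift : ∀ c t : ℕ, c + 1 + t = c + (t + 1) := fun c t => by omega
    have key := @ih (a + 1) (b + 1) (by omega) (by omega)
      (fun t ht => by rw [hshift, hshift]; exact heq (t + 1) (by omega))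
      (by rwa [hshift, hshift])
    rw [hshift, hshift] at key
    rw [← key, suf_eq_cons S (show a ≤ n by omega), suf_eq_cons S (show b ≤ n by omega), slt,
      List.cons_lex_cons_iff]
    simp [h0, slt]

theorem exists_first_mismatch (S : ℕ → α) {a b m : ℕ} (h : ¬ ∀ t < m, S (a + t) = S (b + t)) :
    ∃ r < m, (∀ t < r, S (a + t) = S (b + t)) ∧ S (a + r) ≠ S (b + r) := by
  classical
  have hex : ∃ r, r < m ∧ S (a + r) ≠ S (b + r) := by
    push Not at h
    exact h
  refine ⟨Nat.find hex, (Nat.find_spec hex).1, fun t ht => ?_, (Nat.find_spec hex).2⟩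
  by_contra hne
  exact Nat.find_min hex ht ⟨ht.trans (Nat.find_spec hex).1, hne⟩

theorem le_rlce (S : ℕ → α) {n a b m : ℕ} (ha : a + m ≤ n + 1) (hb : b + m ≤ n + 1)
    (h : ∀ t < m, S (a + t) = S (b + t)) : m ≤ rlce S n a b := by
  unfold rlce lcpLen
  apply Nat.le_findGreatest
  · rw [length_suf, length_suf]; omega
  · rw [take_suf S ha, take_suf S hb]
    apply List.map_congr_left
    intro t ht
    exact h t (List.mem_range.mp ht)

theorem rlce_le (S : ℕ → α) (n a b : ℕ) : rlce S n a b ≤ min (n + 1 - a) (n + 1 - b) := by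
  unfold rlce lcpLen
  refine (Nat.findGreatest_le _).trans ?_
  rw [length_suf, length_suf]

theorem eq_of_lt_rlce (S : ℕ → α) {n a b t : ℕ} (ha : a ≤ n + 1) (hb : b ≤ n + 1)
    (ht : t < rlce S n a b) : S (a + t) = S (b + t) := by
  have hle := rlce_le S n a b
  have h : (suf S n a).take (rlce S n a b) = (suf S n b).take (rlce S n a b) := by
    unfold rlce lcpLen
    exact Nat.findGreatest_spec
      (P := fun k => (suf S n a).take k = (suf S n b).take k) (Nat.zero_le _) (by simp)
  rw [take_suf S (by omega), take_suf S (by omega)] at h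
  exact List.map_inj_left.mp h t (List.mem_range.mpr ht)

theorem nss_spec (S : ℕ → α) {n i j : ℕ} (h : nss S n i = j) (hj : j ≤ n) :
    i < j ∧ slt (suf S n j) (suf S n i) := by
  have hmem : nss S n i ∈ {j | j = n + 1 ∨ (i < j ∧ j ≤ n ∧ slt (suf S n j) (suf S n i))} :=
    Nat.sInf_mem ⟨n + 1, Or.inl rfl⟩
  rw [h] at hmem
  rcases hmem with h | ⟨h₁, _, h₂⟩
  · omega
  · exact ⟨h₁, h₂⟩

theorem not_slt_of_lt_nss (S : ℕ → α) {n i k : ℕ} (hik : i < k) (hkn : k ≤ n)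
    (hk : k < nss S n i) : ¬ slt (suf S n k) (suf S n i) :=
  fun hs => Nat.notMem_of_lt_sInf hk (Or.inr ⟨hik, hkn, hs⟩)

theorem nss_eq_of_forall_not_slt (S : ℕ → α) {n i j : ℕ} (hij : i < j) (hj : j ≤ n)
    (hs : slt (suf S n j) (suf S n i))
    (hmin : ∀ k, i < k → k < j → ¬ slt (suf S n k) (suf S n i)) : nss S n i = j := by
  have hle : nss S n i ≤ j := Nat.sInf_le (Or.inr ⟨hij, hj, hs⟩)
  obtain ⟨h₁, h₂⟩ := nss_spec S rfl (hle.trans hj)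
  by_contra hne
  exact hmin _ h₁ (by omega) h₂

/-- Case R3a: With `nss(i') = j' ≤ n`, `ℓ' = rlce(i',j')`, `d = j' - i'`,
`nss(i) = j`, `j' < i`, `j < j' + ℓ'`: if `nss(i - d) ≠ j - d` then `rlce(i,j) ≥ j' + ℓ' - j`. -/
theorem stmt_12 (S : ℕ → α) (n i' j' ℓ' d i j : ℕ)
    (hi'1 : 1 ≤ i') (h1 : nss S n i' = j') (h2 : j' ≤ n)
    (hl : ℓ' = rlce S n i' j') (hd : d = j' - i')
    (hi1 : 1 ≤ i) (hi2 : i ≤ n) (hj1 : 1 ≤ j) (hj2 : j ≤ n)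
    (h3 : nss S n i = j) (h4 : j' < i) (h5 : j < j' + ℓ')
    (h6 : nss S n (i - d) ≠ j - d) :
    j' + ℓ' - j ≤ rlce S n i j := by
  obtain ⟨hij', -⟩ := nss_spec S h1 h2
  obtain ⟨hij, hs⟩ := nss_spec S h3 hj2
  have hbound := rlce_le S n i' j'
  rw [← hl] at hbound
  have hshift : ∀ x, i' ≤ x → x < i' + ℓ' → S x = S (x + d) := by
    intro x hx₁ hx₂
    have := eq_of_lt_rlce S (n := n) (a := i') (b := j') (t := x - i')
      (by omega) (by omega) (by omega)
    rwa [show i' + (x - i') = x by omega, show j' + (x - i') = x + d by omega] at this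
  have hback : ∀ x t, j' ≤ x → x + t < j' + ℓ' → S (x - d + t) = S (x + t) := by
    intro x t hx₁ hx₂
    rw [hshift (x - d + t) (by omega) (by omega)]
    congr 1
    omega
  by_contra hlt
  obtain ⟨r, hr, heq, hne⟩ := exists_first_mismatch S (a := j) (b := i) (m := j' + ℓ' - j)
    (fun h => hlt (le_rlce S (by omega) (by omega) fun t ht => (h t ht).symm))
  have hrlt := (slt_suf_iff_of_mismatch S (n := n) (by omega) (by omega) heq hne).mp hs
  apply h6
  apply nss_eq_of_forall_not_slt S (by omega) (by omega)
  · rw [slt_suf_iff_of_mismatch S (r := r) (by omega) (by omega)]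
    · rwa [hback j r (by omega) (by omega), hback i r (by omega) (by omega)]
    · intro t ht
      rw [hback j t (by omega) (by omega), hback i t (by omega) (by omega)]
      exact heq t ht
    · rwa [hback j r (by omega) (by omega), hback i r (by omega) (by omega)]
  · intro k hk₁ hk₂
    obtain ⟨K, rfl⟩ : ∃ K, k = K - d := ⟨k + d, by omega⟩
    have hK : ¬ slt (suf S n K) (suf S n i) :=
      not_slt_of_lt_nss S (by omega) (by omega) (by omega)
    by_cases hagree : ∀ t < j' + ℓ' - K, S (K + t) = S (i + t)
    · -- a border of `S[i..j)` yields a suffix smaller than `S_i` that starts before `j`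
      have hborder : ∀ t ≤ r, S (i + (j - K) + t) = S (j + t) := by
        intro t ht
        have := hagree (j - K + t) (by omega)
        rw [show K + (j - K + t) = j + t by omega, ← Nat.add_assoc] at this
        exact this.symm
      refine absurd ?_ (not_slt_of_lt_nss S (n := n) (i := i) (k := i + (j - K))
        (by omega) (by omega) (by omega))
      rw [slt_suf_iff_of_mismatch S (r := r) (by omega) (by omega)]
      · rwa [hborder r le_rfl]
      · intro t ht
        rw [hborder t ht.le, heq t ht]
      · rwa [hborder r le_rfl]
    · obtain ⟨q, hq, hqeq, hqne⟩ := exists_first_mismatch S hagree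
      rw [slt_suf_iff_of_mismatch S (by omega) (by omega) hqeq hqne] at hK
      rw [slt_suf_iff_of_mismatch S (r := q) (by omega) (by omega)]
      · rwa [hback K q (by omega) (by omega), hback i q (by omega) (by omega)]
      · intro t ht
        rw [hback K t (by omega) (by omega), hback i t (by omega) (by omega)]
        exact hqeq t ht
      · rwa [hback K q (by omega) (by omega), hback i q (by omega) (by omega)]
end
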